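/- Let A be a unital purely infinite simple C*-algebra, and let V : A → A be a nuclear unital completely positive map. Then for every ε > 0 and every finite subset F ⊆ A there exists a nonunitary isometry s ∈ A (i.e. s*·s = 1 and s·s* ≠ 1) such that ‖s*·a·s − V(a)‖ < ε for all a ∈ F. -/

import Mathlib

/-- A square matrix over a ∗-ring is positive if it is of the form `Yᴴ·Y`.
(In a C*-algebra this is the usual notion of positivity.) -/
def MatPos {R : Type*} [NonUnitalSemiring R] [StarRing R] {k : ℕ}
    (X : Matrix (Fin k) (Fin k) R) : Prop :=
  ∃ Y : Matrix (Fin k) (Fin k) R, X = star Y * Y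

/-- A linear map between C*-algebras is completely positive if all of its entrywise
amplifications to matrix algebras map positive matrices to positive matrices. -/
def IsCP {A B : Type*} [NonUnitalSemiring A] [StarRing A] [Module ℂ A]
    [NonUnitalSemiring B] [StarRing B] [Module ℂ B] (T : A →ₗ[ℂ] B) : Prop :=
  ∀ (k : ℕ) (X : Matrix (Fin k) (Fin k) A), MatPos X → MatPos (X.map fun x => T x)

section PurelyInfinite

variable {A : Type*} [CStarAlgebra A]

lemma cfc_ne_zero_of_mem_spectrum {x : A} (hx : IsSelfAdjoint x) {f : ℝ → ℝ}
    (hf : Continuous f) {r : ℝ} (hr : r ∈ spectrum ℝ x) (hfr : f r ≠ 0) : cfc f x ≠ 0 := by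
  intro h
  have hle := (norm_cfc_le_iff f x le_rfl hf.continuousOn hx).1 (by simp [h]) r hr
  exact hfr (norm_le_zero_iff.1 hle)

lemma norm_star_mul_mul_le_of_isometry [Nontrivial A] {s t : A} (hs : star s * s = 1) (ht : star t * t = 1)
    (y : A) : ‖star s * y * t‖ ≤ ‖y‖ := by
  have key : ∀ u : A, star u * u = 1 → ‖u‖ ≤ 1 := by
    intro u hu
    have h1 : ‖u‖ * ‖u‖ ≤ 1 := by
      rw [← CStarRing.norm_star_mul_self, hu, CStarRing.norm_one]
    nlinarith [norm_nonneg u]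
  calc ‖star s * y * t‖ ≤ ‖star s‖ * ‖y‖ * ‖t‖ := norm_mul₃_le
    _ ≤ 1 * ‖y‖ * 1 := by
      gcongr
      · rw [norm_star]; exact key s hs
      · exact key t ht
    _ = ‖y‖ := by ring

/-- An element close to the identity has an inverse square root close to the identity. -/
lemma exists_inv_sqrt_near_one {z : A} (hz : IsSelfAdjoint z) {δ : ℝ} (hδ0 : 0 ≤ δ)
    (hδ : δ ≤ 1 / 2) (hzδ : ‖z - 1‖ ≤ δ) :
    ∃ h : A, star h = h ∧ h * z * h = 1 ∧ ‖h - 1‖ ≤ δ := by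
  have hspec : ∀ r ∈ spectrum ℝ z, |r - 1| ≤ δ := by
    have heq : cfc (fun r : ℝ => r - 1) z = z - 1 := by
      rw [cfc_sub (fun r : ℝ => r) (fun _ => (1 : ℝ)) z, cfc_id' ℝ z, cfc_const_one ℝ z]
    intro r hr
    have := (norm_cfc_le_iff (fun r : ℝ => r - 1) z hδ0 (by fun_prop) hz).1 (by rwa [heq]) r hr
    simpa using this
  have hpos : ∀ r ∈ spectrum ℝ z, 0 < r := by
    intro r hr
    have := abs_le.1 (hspec r hr)
    linarith [this.1]
  have hc : ContinuousOn (fun r : ℝ => (√r)⁻¹) (spectrum ℝ z) := by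
    apply ContinuousOn.inv₀ Real.continuous_sqrt.continuousOn
    intro r hr
    exact (Real.sqrt_pos.2 (hpos r hr)).ne'
  refine ⟨cfc (fun r : ℝ => (√r)⁻¹) z, IsSelfAdjoint.cfc, ?_, ?_⟩
  · conv_lhs => enter [1, 2]; rw [← cfc_id' ℝ z]
    rw [← cfc_mul _ _ z hc (by fun_prop), ← cfc_mul _ _ z (by fun_prop) hc, ← cfc_const_one ℝ z]
    apply cfc_congr
    intro r hr
    have h0 := Real.sqrt_pos.2 (hpos r hr)
    have h1 := Real.mul_self_sqrt (hpos r hr).le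
    show (√r)⁻¹ * r * (√r)⁻¹ = 1
    field_simp
    nlinarith
  · rw [← cfc_const_one ℝ z, ← cfc_sub _ _ z hc (by fun_prop)]
    apply norm_cfc_le hδ0
    intro r hr
    have h0 := Real.sqrt_pos.2 (hpos r hr)
    have h1 := Real.mul_self_sqrt (hpos r hr).le
    have h2 := abs_le.1 (hspec r hr)
    set q := √r
    have h3 : 1 / 2 ≤ q := by nlinarith
    have h4 : 1 ≤ q * (1 + q) := by nlinarith
    have h5 : q⁻¹ - 1 = (1 - r) / (q * (1 + q)) := by
      field_simp
      nlinarith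
    rw [Real.norm_eq_abs, h5, abs_div, abs_of_pos (show 0 < q * (1 + q) by positivity),
      abs_sub_comm]
    exact (div_le_self (abs_nonneg _) h4).trans (hspec r hr)

lemma exists_star_mul_self_eq_one [PartialOrder A] [StarOrderedRing A]
    (hpi : ∀ x : A, x ≠ 0 → ∃ a b : A, a * x * b = 1) {f : A} (hf : f ≠ 0) :
    ∃ b : A, star (f * b) * (f * b) = 1 := by
  obtain ⟨x, y, hxy⟩ := hpi f hf
  set u := f * y with hu
  have hxu : x * u = 1 := by rw [hu, ← mul_assoc, hxy]
  have h1 : (1 : A) ≤ ‖x‖ ^ 2 • (star u * u) := by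
    have h2 : star x * x ≤ algebraMap ℝ A (‖x‖ ^ 2) := CStarAlgebra.star_mul_le_algebraMap_norm_sq
    have h3 := star_left_conjugate_le_conjugate h2 u
    have h4 : star u * (star x * x) * u = 1 := by
      rw [show star u * (star x * x) * u = star (x * u) * (x * u) by
        rw [star_mul x u]; simp only [mul_assoc], hxu]; simp
    rw [h4, Algebra.algebraMap_eq_smul_one] at h3
    simpa using h3
  have h5 : IsUnit (‖x‖ ^ 2 • (star u * u)) := CStarAlgebra.isUnit_of_le 1 h1
  have h6 : IsUnit (star u * u) := by
    rw [← smul_one_mul] at h5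
    have hcomm : Commute (‖x‖ ^ 2 • (1 : A)) (star u * u) := by
      simp [Commute, SemiconjBy]
    exact (hcomm.isUnit_mul_iff.1 h5).2
  have h7 : IsStrictlyPositive (star u * u) :=
    h6.isStrictlyPositive (star_mul_self_nonneg u)
  have h8 := CFC.conjugate_rpow_neg_one_half (star u * u) h7
  refine ⟨y * (star u * u) ^ (-(1 / 2) : ℝ), ?_⟩
  have h9 : star ((star u * u) ^ (-(1 / 2) : ℝ)) = (star u * u) ^ (-(1 / 2) : ℝ) :=
    (IsSelfAdjoint.of_nonneg CFC.rpow_nonneg).star_eq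
  rw [show f * (y * (star u * u) ^ (-(1 / 2) : ℝ)) = u * (star u * u) ^ (-(1 / 2) : ℝ) by
    rw [hu, mul_assoc], star_mul, h9, ← h8]
  noncomm_ring

/-- Excision of a single self-adjoint element. -/
lemma exists_isometry_compress_near_scalar [PartialOrder A] [StarOrderedRing A] [Nontrivial A]
    (hpi : ∀ x : A, x ≠ 0 → ∃ a b : A, a * x * b = 1) {x : A} (hx : IsSelfAdjoint x)
    {ε : ℝ} (hε : 0 < ε) :
    ∃ (t : A) (c : ℝ), star t * t = 1 ∧ ‖star t * x * t - (c : ℂ) • (1 : A)‖ ≤ ε := by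
  obtain ⟨r₀, hr₀⟩ := ContinuousFunctionalCalculus.spectrum_nonempty (R := ℝ) x hx
  let f : ℝ → ℝ := fun r => max 0 (ε - |r - r₀|)
  have hf : Continuous f := by fun_prop
  let g : ℝ → ℝ := fun r => max (-ε) (min ε (r - r₀))
  have hg : Continuous g := by fun_prop
  obtain ⟨b, hb⟩ := exists_star_mul_self_eq_one hpi
    (cfc_ne_zero_of_mem_spectrum hx hf hr₀ (by simp [f, hε.le, hε.ne']))
  refine ⟨cfc f x * b, r₀, hb, ?_⟩
  have hfg : (x - (r₀ : ℂ) • (1 : A)) * cfc f x = cfc g x * cfc f x := by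
    have hxr : x - (r₀ : ℂ) • (1 : A) = cfc (fun r : ℝ => r - r₀) x := by
      rw [cfc_sub (fun r : ℝ => r) (fun _ => r₀) x, cfc_id' ℝ x, cfc_const r₀ x,
        Algebra.algebraMap_eq_smul_one, Complex.coe_smul]
    rw [hxr, ← cfc_mul _ _ x (by fun_prop) hf.continuousOn,
      ← cfc_mul _ _ x hg.continuousOn hf.continuousOn]
    apply cfc_congr
    intro r _
    by_cases h : |r - r₀| ≤ ε
    · have := abs_le.1 h
      simp [f, g, this.1, this.2]
    · have : f r = 0 := by simp only [f]; exact max_eq_left (by linarith)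
      simp [this]
  have hrew : star (cfc f x * b) * x * (cfc f x * b) - (r₀ : ℂ) • (1 : A)
      = star (cfc f x * b) * cfc g x * (cfc f x * b) := by
    calc _ = star (cfc f x * b) * x * (cfc f x * b)
          - (r₀ : ℂ) • (star (cfc f x * b) * (cfc f x * b)) := by rw [hb]
      _ = star (cfc f x * b) * ((x - (r₀ : ℂ) • (1 : A)) * cfc f x) * b := by
        simp only [mul_sub, sub_mul, mul_assoc, smul_mul_assoc, mul_smul_comm, one_mul]
      _ = _ := by rw [hfg]; simp only [mul_assoc]
  rw [hrew]
  refine (norm_star_mul_mul_le_of_isometry hb hb _).trans (norm_cfc_le hε.le ?_)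
  intro r _
  rw [Real.norm_eq_abs, abs_le]
  exact ⟨le_max_left _ _, max_le (by linarith) (min_le_left _ _)⟩

lemma exists_neg_compression [PartialOrder A] [StarOrderedRing A]
    (hpi : ∀ x : A, x ≠ 0 → ∃ a b : A, a * x * b = 1) {x : A} (hx : IsSelfAdjoint x)
    (hneg : ¬ 0 ≤ x) : ∃ v : A, star v * x * v = -1 := by
  have : ∃ r ∈ spectrum ℝ x, r < 0 := by
    by_contra! h
    exact hneg ((StarOrderedRing.nonneg_iff_spectrum_nonneg x hx).2 h)
  obtain ⟨r, hr, hr0⟩ := this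
  let k : ℝ → ℝ := fun r => max 0 (-r)
  have hk : Continuous k := by fun_prop
  have hsk : Continuous (fun r => √(k r)) := by fun_prop
  obtain ⟨b, hb⟩ := exists_star_mul_self_eq_one hpi
    (cfc_ne_zero_of_mem_spectrum hx hk hr (by simp [k, hr0]))
  have hkk : cfc (fun r => √(k r)) x * x * cfc (fun r => √(k r)) x = - (cfc k x * cfc k x) := by
    conv_lhs => enter [1, 2]; rw [← cfc_id' ℝ x]
    rw [← cfc_mul _ _ x hsk.continuousOn (by fun_prop),
      ← cfc_mul _ _ x (by fun_prop) hsk.continuousOn,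
      ← cfc_mul _ _ x hk.continuousOn hk.continuousOn, ← cfc_neg]
    apply cfc_congr
    intro r _
    have h1 : √(k r) * √(k r) = k r := Real.mul_self_sqrt (le_max_left _ _)
    have h2 : k r * r = - (k r * k r) := by
      rcases le_total 0 (-r) with h | h
      · simp [k, h]
      · simp [k, max_eq_left h]
    show √(k r) * r * √(k r) = -(k r * k r)
    rw [← h2]; linear_combination r * h1
  refine ⟨cfc (fun r => √(k r)) x * b, ?_⟩
  have hs1 : star (cfc (fun r => √(k r)) x) = cfc (fun r => √(k r)) x := IsSelfAdjoint.cfc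
  have hs2 : star (cfc k x) = cfc k x := IsSelfAdjoint.cfc
  calc _ = star b * (cfc (fun r => √(k r)) x * x * cfc (fun r => √(k r)) x) * b := by
        rw [star_mul, hs1]; noncomm_ring
    _ = - (star (cfc k x * b) * (cfc k x * b)) := by
        rw [hkk, star_mul, hs2]; noncomm_ring
    _ = -1 := by rw [hb]

/-- Excision of finitely many elements. -/
lemma exists_isometry_compress_finite [PartialOrder A] [StarOrderedRing A] [Nontrivial A]
    (hpi : ∀ x : A, x ≠ 0 → ∃ a b : A, a * x * b = 1) {ε : ℝ} (hε : 0 < ε) (X : Finset A) :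
    ∃ t : A, star t * t = 1 ∧
      ∀ x ∈ X, ∃ c : ℂ, ‖star t * x * t - c • (1 : A)‖ ≤ ε := by
  classical
  induction X using Finset.induction_on with
  | empty => exact ⟨1, by simp, by simp⟩
  | insert x X _ ih =>
    obtain ⟨t, ht, hX⟩ := ih
    set y := star t * x * t with hy
    obtain ⟨t₁, c₁, ht₁, hc₁⟩ := exists_isometry_compress_near_scalar hpi
      (realPart y).2 (half_pos hε)
    obtain ⟨t₂, c₂, ht₂, hc₂⟩ := exists_isometry_compress_near_scalar hpi
      (x := star t₁ * (imaginaryPart y : A) * t₁)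
      ((imaginaryPart y).2.conjugate' t₁) (half_pos hε)
    have comp : ∀ {p q : A}, star p * p = 1 → star q * q = 1 → star (p * q) * (p * q) = 1 := by
      intro p q hp hq
      rw [star_mul, mul_assoc, ← mul_assoc (star p), hp, one_mul, hq]
    have push : ∀ {q : A} {z : A} {c : ℂ} {η : ℝ}, star q * q = 1 → ‖z - c • (1 : A)‖ ≤ η →
        ‖star q * z * q - c • (1 : A)‖ ≤ η := by
      intro q z c η hq hz
      have : star q * z * q - c • (1 : A) = star q * (z - c • (1 : A)) * q := by
        rw [mul_sub, sub_mul, mul_smul_comm, mul_one, smul_mul_assoc, hq]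
      rw [this]
      exact (norm_star_mul_mul_le_of_isometry hq hq _).trans hz
    refine ⟨t * (t₁ * t₂), comp ht (comp ht₁ ht₂), ?_⟩
    have hassoc : ∀ z : A, star (t * (t₁ * t₂)) * z * (t * (t₁ * t₂))
        = star (t₁ * t₂) * (star t * z * t) * (t₁ * t₂) := by
      intro z; simp only [star_mul, mul_assoc]
    intro z hz
    rw [Finset.mem_insert] at hz
    rcases hz with rfl | hz
    · refine ⟨c₁ + Complex.I * c₂, ?_⟩
      rw [hassoc, ← hy]
      have e : star (t₁ * t₂) * y * (t₁ * t₂) - ((c₁ : ℂ) + Complex.I * c₂) • (1 : A)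
          = (star t₂ * (star t₁ * (realPart y : A) * t₁) * t₂ - (c₁ : ℂ) • (1 : A))
            + Complex.I • (star t₂ * (star t₁ * (imaginaryPart y : A) * t₁) * t₂
              - (c₂ : ℂ) • (1 : A)) := by
        conv_lhs => rw [← realPart_add_I_smul_imaginaryPart y]
        simp only [star_mul, mul_add, add_mul, mul_smul_comm, smul_mul_assoc, smul_sub, add_smul,
          mul_smul, mul_assoc]
        abel
      rw [e]
      refine (norm_add_le _ _).trans ?_
      rw [norm_smul, Complex.norm_I, one_mul]
      linarith [push ht₂ hc₁]
    · obtain ⟨c, hc⟩ := hX z hz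
      exact ⟨c, by rw [hassoc]; exact push (comp ht₁ ht₂) hc⟩

lemma exists_orthogonal_isometries [PartialOrder A] [StarOrderedRing A]
    (hnontriv : ∃ x : A, ∀ c : ℂ, x ≠ c • (1 : A))
    (hpi : ∀ x : A, x ≠ 0 → ∃ a b : A, a * x * b = 1) :
    ∃ s t : A, star s * s = 1 ∧ star t * t = 1 ∧ star t * s = 0 := by
  have hsa : ∃ x : A, IsSelfAdjoint x ∧ ∀ c : ℂ, x ≠ c • (1 : A) := by
    by_contra! h
    obtain ⟨x, hx⟩ := hnontriv
    obtain ⟨c, hc⟩ := h _ (realPart x).2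
    obtain ⟨d, hd⟩ := h _ (imaginaryPart x).2
    apply hx (c + Complex.I * d)
    conv_lhs => rw [← realPart_add_I_smul_imaginaryPart x, hc, hd]
    rw [add_smul, mul_smul]
  obtain ⟨x, hx, hxc⟩ := hsa
  have : ∃ p ∈ spectrum ℝ x, ∃ q ∈ spectrum ℝ x, p < q := by
    by_contra! h
    have hnt : Nontrivial A := ⟨x, (0 : ℂ) • 1, hxc 0⟩
    obtain ⟨r, hr⟩ := ContinuousFunctionalCalculus.spectrum_nonempty (R := ℝ) x hx
    apply hxc r
    have heq : cfc (fun r : ℝ => r) x = cfc (fun _ => r) x := by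
      apply cfc_congr
      intro q hq
      exact le_antisymm (h r hr q hq) (h q hq r hr)
    rw [cfc_id' ℝ x, cfc_const r x, Algebra.algebraMap_eq_smul_one] at heq
    rw [heq, Complex.coe_smul]
  obtain ⟨p, hp, q, hq, hpq⟩ := this
  let f : ℝ → ℝ := fun r => max 0 (r - (p + q) / 2)
  let g : ℝ → ℝ := fun r => max 0 ((p + q) / 2 - r)
  have hf : Continuous f := by fun_prop
  have hg : Continuous g := by fun_prop
  obtain ⟨b, hb⟩ := exists_star_mul_self_eq_one hpi
    (cfc_ne_zero_of_mem_spectrum hx hf hq (by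
      have : 0 < q - (p + q) / 2 := by linarith
      simp only [f]; rw [max_eq_right this.le]; exact this.ne'))
  obtain ⟨d, hd⟩ := exists_star_mul_self_eq_one hpi
    (cfc_ne_zero_of_mem_spectrum hx hg hp (by
      have : 0 < (p + q) / 2 - p := by linarith
      simp only [g]; rw [max_eq_right this.le]; exact this.ne'))
  refine ⟨_, _, hb, hd, ?_⟩
  have hgs : star (cfc g x) = cfc g x := IsSelfAdjoint.cfc
  have hgf : cfc g x * cfc f x = 0 := by
    rw [← cfc_mul _ _ x hg.continuousOn hf.continuousOn, ← cfc_const_zero ℝ x]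
    apply cfc_congr
    intro r _
    rcases le_total r ((p + q) / 2) with h | h
    · simp [f, max_eq_left (sub_nonpos.2 h)]
    · simp [g, max_eq_left (sub_nonpos.2 h)]
  rw [star_mul, hgs, mul_assoc, ← mul_assoc (cfc g x), hgf]
  simp

/-- The relations of infinitely many Cuntz isometries. -/
lemma exists_cuntz_sequence [PartialOrder A] [StarOrderedRing A]
    (hnontriv : ∃ x : A, ∀ c : ℂ, x ≠ c • (1 : A))
    (hpi : ∀ x : A, x ≠ 0 → ∃ a b : A, a * x * b = 1) :
    ∃ r : ℕ → A, ∀ k l, star (r k) * r l = if k = l then 1 else 0 := by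
  obtain ⟨s, t, hs, ht, hst⟩ := exists_orthogonal_isometries hnontriv hpi
  have hpow : ∀ k, star (s ^ k) * s ^ k = 1 := by
    intro k
    induction k with
    | zero => simp
    | succ k ih =>
      rw [pow_succ, star_mul, mul_assoc, ← mul_assoc (star (s ^ k)), ih, one_mul, hs]
  have hlt : ∀ k l, k < l → star (s ^ k * t) * (s ^ l * t) = 0 := by
    intro k l h
    obtain ⟨m, rfl⟩ := Nat.exists_eq_add_of_lt h
    calc star (s ^ k * t) * (s ^ (k + m + 1) * t)
        = star t * (star (s ^ k) * s ^ k) * (s * s ^ m) * t := by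
          rw [star_mul, add_assoc, pow_add, pow_succ' s m]; simp only [mul_assoc]
      _ = star t * s * s ^ m * t := by rw [hpow, mul_one]; simp only [mul_assoc]
      _ = 0 := by rw [hst]; simp
  refine ⟨fun k => s ^ k * t, fun k l => ?_⟩
  rcases lt_trichotomy k l with h | rfl | h
  · rw [if_neg h.ne]; exact hlt k l h
  · simp only [if_true]
    rw [star_mul, mul_assoc, ← mul_assoc (star (s ^ k)), hpow, one_mul, ht]
  · rw [if_neg h.ne']
    have := congrArg star (hlt l k h)
    simpa [star_mul, mul_assoc] using this

lemma norm_sub_re_smul_le {y : A} (hy : IsSelfAdjoint y) (c : ℂ) :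
    ‖y - (c.re : ℂ) • (1 : A)‖ ≤ ‖y - c • (1 : A)‖ := by
  have h := realPart.norm_le (y - c • (1 : A))
  have e : ((realPart (y - c • (1 : A)) : selfAdjoint A) : A) = y - (c.re : ℂ) • (1 : A) := by
    rw [realPart_apply_coe]
    simp only [star_sub, star_smul, hy.star_eq, star_one]
    have hc : (2⁻¹ : ℝ) • (c • (1 : A) + star c • (1 : A)) = (c.re : ℂ) • (1 : A) := by
      rw [← add_smul, ← Complex.coe_smul, smul_smul]
      congr 1
      have : c + star c = ((2 * c.re : ℝ) : ℂ) := Complex.add_conj c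
      rw [this]; push_cast; ring
    rw [← hc]
    have : y = (2⁻¹ : ℝ) • (y + y) := by
      rw [← two_smul ℝ y, smul_smul]; norm_num
    conv_rhs => rw [this]
    rw [← smul_sub]
    congr 1
    abel
  rw [← e]
  exact h

/-- Finitely many self-adjoint elements can be excised, to any accuracy, at a common scalar
tuple. -/
lemma exists_scalars_excised [PartialOrder A] [StarOrderedRing A] [Nontrivial A]
    (hpi : ∀ x : A, x ≠ 0 → ∃ a b : A, a * x * b = 1) {ι : Type*} [Fintype ι]
    (y : ι → A) (hy : ∀ i, IsSelfAdjoint (y i)) :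
    ∃ c : ι → ℝ, ∀ ε > 0, ∃ t : A, star t * t = 1 ∧
      ∀ i, ‖star t * y i * t - (c i : ℂ) • (1 : A)‖ < ε := by
  classical
  have hn : ∀ n : ℕ, ∃ (t : A) (c : ι → ℝ), star t * t = 1 ∧
      ∀ i, ‖star t * y i * t - (c i : ℂ) • (1 : A)‖ ≤ 1 / ((n : ℝ) + 1) := by
    intro n
    obtain ⟨t, ht, h⟩ := exists_isometry_compress_finite hpi
      (Nat.one_div_pos_of_nat (α := ℝ) (n := n)) (Finset.univ.image y)
    choose c hc using fun i => h (y i) (Finset.mem_image_of_mem y (Finset.mem_univ i))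
    exact ⟨t, fun i => (c i).re, ht, fun i =>
      (norm_sub_re_smul_le ((hy i).conjugate' t) (c i)).trans (hc i)⟩
  choose t c ht hc using hn
  have hbdd : ∀ n, c n ∈ Metric.closedBall (0 : ι → ℝ) (∑ i, ‖y i‖ + 1) := by
    intro n
    rw [mem_closedBall_zero_iff, pi_norm_le_iff_of_nonneg (by positivity)]
    intro i
    have h1 : ‖((c n i : ℂ)) • (1 : A)‖ = ‖c n i‖ := by
      rw [norm_smul, CStarRing.norm_one, mul_one, Complex.norm_real]
    have h2 : ‖((c n i : ℂ)) • (1 : A)‖ ≤ ‖star (t n) * y i * t n‖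
        + ‖star (t n) * y i * t n - (c n i : ℂ) • (1 : A)‖ := norm_le_norm_add_norm_sub _ _
    have h3 := norm_star_mul_mul_le_of_isometry (ht n) (ht n) (y i)
    have h4 : 1 / ((n : ℝ) + 1) ≤ 1 := by
      rw [div_le_one (by positivity)]; linarith [n.cast_nonneg (α := ℝ)]
    have h5 := Finset.single_le_sum (f := fun i => ‖y i‖) (fun i _ => norm_nonneg _)
      (Finset.mem_univ i)
    linarith [hc n i]
  obtain ⟨c₀, -, φ, hφ, hlim⟩ := (isCompact_closedBall _ _).tendsto_subseq hbdd
  refine ⟨c₀, fun ε hε => ?_⟩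
  have h1 : ∀ᶠ n in Filter.atTop, ‖c (φ n) - c₀‖ < ε / 2 := by
    filter_upwards [Metric.tendsto_nhds.1 hlim (ε / 2) (half_pos hε)] with n h
    rwa [dist_eq_norm] at h
  have h2 : ∀ᶠ n in Filter.atTop, 1 / ((φ n : ℝ) + 1) < ε / 2 :=
    ((tendsto_one_div_add_atTop_nhds_zero_nat (𝕜 := ℝ)).comp hφ.tendsto_atTop).eventually
      (gt_mem_nhds (half_pos hε))
  obtain ⟨n, hn1, hn2⟩ := (h1.and h2).exists
  refine ⟨t (φ n), ht _, fun i => ?_⟩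
  have e : star (t (φ n)) * y i * t (φ n) - (c₀ i : ℂ) • (1 : A)
      = (star (t (φ n)) * y i * t (φ n) - (c (φ n) i : ℂ) • (1 : A))
        + ((c (φ n) i - c₀ i : ℝ) : ℂ) • (1 : A) := by
    push_cast; rw [sub_smul]; abel
  rw [e]
  refine (norm_add_le _ _).trans_lt ?_
  rw [norm_smul, CStarRing.norm_one, mul_one, Complex.norm_real]
  have h3 := norm_le_pi_norm (c (φ n) - c₀) i
  rw [Pi.sub_apply] at h3
  linarith [hc (φ n) i]

/-- The real tuples that are limits of simultaneous compressions `w* aᵢ w`. -/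
def compressionCone {ι : Type*} (a : ι → A) : Set (ι → ℝ) :=
  {c | ∀ ε > 0, ∃ w : A, ∀ i, ‖star w * a i * w - (c i : ℂ) • (1 : A)‖ < ε}

lemma zero_mem_compressionCone {ι : Type*} (a : ι → A) : (0 : ι → ℝ) ∈ compressionCone a :=
  fun ε hε => ⟨0, fun i => by simpa using hε⟩

lemma smul_mem_compressionCone {ι : Type*} {a : ι → A} {c : ι → ℝ} (hc : c ∈ compressionCone a)
    {r : ℝ} (hr : 0 ≤ r) : r • c ∈ compressionCone a := by
  intro ε hε
  obtain ⟨w, hw⟩ := hc (ε / (r + 1)) (by positivity)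
  refine ⟨(√r : ℂ) • w, fun i => ?_⟩
  have hsq : (√r : ℂ) * (√r : ℂ) = (r : ℂ) := by
    rw [← Complex.ofReal_mul, Real.mul_self_sqrt hr]
  have e : star ((√r : ℂ) • w) * a i * ((√r : ℂ) • w) - (((r • c) i : ℝ) : ℂ) • (1 : A)
      = (r : ℂ) • (star w * a i * w - (c i : ℂ) • (1 : A)) := by
    have hst : star (√r : ℂ) = (√r : ℂ) := Complex.conj_ofReal _
    simp only [star_smul, hst, smul_mul_assoc, mul_smul_comm, smul_smul, hsq, smul_sub,
      Pi.smul_apply, smul_eq_mul, Complex.ofReal_mul]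
  rw [e, norm_smul, Complex.norm_real, Real.norm_of_nonneg hr]
  calc r * _ ≤ r * (ε / (r + 1)) := by gcongr; exact (hw i).le
    _ = ε * (r / (r + 1)) := by ring
    _ < ε * 1 := by
      gcongr
      rw [div_lt_one (by positivity)]; linarith
    _ = ε := mul_one _

lemma add_mem_compressionCone [PartialOrder A] [StarOrderedRing A] [Nontrivial A]
    (hnontriv : ∃ x : A, ∀ c : ℂ, x ≠ c • (1 : A))
    (hpi : ∀ x : A, x ≠ 0 → ∃ a b : A, a * x * b = 1) {ι : Type*} [Fintype ι] {a : ι → A}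
    (ha : ∀ i, IsSelfAdjoint (a i)) {c d : ι → ℝ} (hc : c ∈ compressionCone a)
    (hd : d ∈ compressionCone a) : c + d ∈ compressionCone a := by
  classical
  intro ε hε
  obtain ⟨w, hw⟩ := hc (ε / 4) (by positivity)
  obtain ⟨z, hz⟩ := hd (ε / 4) (by positivity)
  obtain ⟨p, q, hp, hq, hqp⟩ := exists_orthogonal_isometries hnontriv hpi
  obtain ⟨t, ht, hX⟩ := exists_isometry_compress_finite hpi (show 0 < ε / 8 by positivity)
    (Finset.univ.image fun i => star z * a i * w)
  have comp : ∀ {u : A}, star u * u = 1 → star (t * u) * (t * u) = 1 := by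
    intro u hu
    rw [star_mul, mul_assoc, ← mul_assoc (star t), ht, one_mul, hu]
  refine ⟨w * (t * p) + z * (t * q), fun i => ?_⟩
  obtain ⟨x, hx⟩ := hX _ (Finset.mem_image_of_mem _ (Finset.mem_univ i))
  set D₁ := star (t * p) * (star w * a i * w - (c i : ℂ) • (1 : A)) * (t * p) with hD₁
  set D₂ := star (t * q) * (star z * a i * z - (d i : ℂ) • (1 : A)) * (t * q) with hD₂
  set E := star (t * q) * (star z * a i * w) * (t * p) with hE
  have e : star (w * (t * p) + z * (t * q)) * a i * (w * (t * p) + z * (t * q))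
      - (((c + d) i : ℝ) : ℂ) • (1 : A) = D₁ + D₂ + (E + star E) := by
    have e1 : D₁ = star (t * p) * (star w * a i * w) * (t * p) - (c i : ℂ) • (1 : A) := by
      rw [hD₁, mul_sub, sub_mul, mul_smul_comm, mul_one, smul_mul_assoc, comp hp]
    have e2 : D₂ = star (t * q) * (star z * a i * z) * (t * q) - (d i : ℂ) • (1 : A) := by
      rw [hD₂, mul_sub, sub_mul, mul_smul_comm, mul_one, smul_mul_assoc, comp hq]
    have e3 : star E = star (t * p) * (star w * a i * z) * (t * q) := by
      rw [hE]
      simp only [star_mul, star_star, (ha i).star_eq, mul_assoc]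
    rw [e1, e2, e3, hE]
    simp only [star_add, star_mul, add_mul, mul_add, mul_assoc, Pi.add_apply,
      Complex.ofReal_add, add_smul]
    abel
  have hEn : ‖E‖ ≤ ε / 8 := by
    have : E = star q * (star t * (star z * a i * w) * t - x • (1 : A)) * p := by
      rw [mul_sub, sub_mul, mul_smul_comm, mul_one, smul_mul_assoc, hqp, smul_zero, sub_zero, hE]
      simp only [star_mul, mul_assoc]
    rw [this]
    exact (norm_star_mul_mul_le_of_isometry hq hp _).trans hx
  have h1 := (norm_star_mul_mul_le_of_isometry (comp hp) (comp hp) _).trans_lt (hw i)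
  have h2 := (norm_star_mul_mul_le_of_isometry (comp hq) (comp hq) _).trans_lt (hz i)
  rw [e]
  calc _ ≤ ‖D₁‖ + ‖D₂‖ + (‖E‖ + ‖star E‖) :=
        (norm_add_le _ _).trans (add_le_add (norm_add_le _ _) (norm_add_le _ _))
    _ < ε := by rw [norm_star]; linarith

lemma isClosed_compressionCone [Nontrivial A] {ι : Type*} [Fintype ι] (a : ι → A) :
    IsClosed (compressionCone a) := by
  refine isClosed_of_closure_subset fun c hc ε hε => ?_
  obtain ⟨d, hd, hcd⟩ := Metric.mem_closure_iff.1 hc (ε / 2) (half_pos hε)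
  obtain ⟨w, hw⟩ := hd (ε / 2) (half_pos hε)
  refine ⟨w, fun i => ?_⟩
  have e : star w * a i * w - (c i : ℂ) • (1 : A)
      = (star w * a i * w - (d i : ℂ) • (1 : A)) - ((c i - d i : ℝ) : ℂ) • (1 : A) := by
    push_cast; rw [sub_smul]; abel
  rw [e]
  refine (norm_sub_le _ _).trans_lt ?_
  rw [norm_smul, CStarRing.norm_one, mul_one, Complex.norm_real]
  have h3 := norm_le_pi_norm (c - d) i
  rw [Pi.sub_apply, ← dist_eq_norm c d] at h3
  linarith [hw i]

open scoped ComplexOrder in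
lemma IsSelfAdjoint.im_map_eq_zero_of_positive [PartialOrder A] [StarOrderedRing A]
    {g : A →ₗ[ℂ] ℂ} (hg : ∀ y, 0 ≤ g (star y * y)) {x : A} (hx : IsSelfAdjoint x) :
    (g x).im = 0 := by
  have hnn : ∀ z : A, 0 ≤ z → (g z).im = 0 := by
    intro z hz
    obtain ⟨y, rfl⟩ := CStarAlgebra.nonneg_iff_eq_star_mul_self.1 hz
    exact ((Complex.le_def.1 (hg y)).2).symm
  rw [← CFC.posPart_sub_negPart x hx, map_sub, Complex.sub_im,
    hnn _ (CFC.posPart_nonneg x), hnn _ (CFC.negPart_nonneg x), sub_zero]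

open scoped ComplexOrder in
lemma positive_functional_mem_compressionCone [PartialOrder A] [StarOrderedRing A] [Nontrivial A]
    (hnontriv : ∃ x : A, ∀ c : ℂ, x ≠ c • (1 : A))
    (hpi : ∀ x : A, x ≠ 0 → ∃ a b : A, a * x * b = 1) {ι : Type*} [Fintype ι] {a : ι → A}
    (ha : ∀ i, IsSelfAdjoint (a i)) {g : A →ₗ[ℂ] ℂ} (hg : ∀ y, 0 ≤ g (star y * y)) :
    (fun i => (g (a i)).re) ∈ compressionCone a := by
  classical
  by_contra hmem
  have hconv : Convex ℝ (compressionCone a) := by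
    intro x hx y hy r s hr hs _
    exact add_mem_compressionCone hnontriv hpi ha (smul_mem_compressionCone hx hr)
      (smul_mem_compressionCone hy hs)
  obtain ⟨f, u, hfC, hfu⟩ :=
    geometric_hahn_banach_closed_point hconv (isClosed_compressionCone a) hmem
  have hu : 0 < u := by simpa using hfC 0 (zero_mem_compressionCone a)
  set α : ι → ℝ := fun i => f (Pi.single i 1) with hα
  have hf : ∀ c : ι → ℝ, f c = ∑ i, α i * c i := by
    intro c
    conv_lhs => rw [pi_eq_sum_univ' c]
    rw [map_sum]
    refine Finset.sum_congr rfl fun i _ => ?_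
    rw [map_smul, smul_eq_mul, mul_comm, hα]
  set x : A := -∑ i, (α i : ℂ) • a i with hx
  have hxsa : IsSelfAdjoint x := by
    rw [IsSelfAdjoint, hx, star_neg, star_sum]
    congr 1
    refine Finset.sum_congr rfl fun i _ => ?_
    rw [star_smul, (ha i).star_eq]
    congr 1
    exact Complex.conj_ofReal _
  have hxneg : ¬ 0 ≤ x := by
    intro h
    obtain ⟨y, hy⟩ := CStarAlgebra.nonneg_iff_eq_star_mul_self.1 h
    have h1 : 0 ≤ (g x).re := by rw [hy]; exact (Complex.le_def.1 (hg y)).1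
    have h2 : (g x).re = - ∑ i, α i * (g (a i)).re := by
      rw [hx, map_neg, map_sum, Complex.neg_re, Complex.re_sum]
      congr 1
      refine Finset.sum_congr rfl fun i _ => ?_
      rw [map_smul, smul_eq_mul, Complex.re_ofReal_mul]
    rw [hf] at hfu
    linarith
  obtain ⟨v, hv⟩ := exists_neg_compression hpi hxsa hxneg
  obtain ⟨c, hc⟩ := exists_scalars_excised hpi (fun i => star v * a i * v)
    (fun i => (ha i).conjugate' v)
  have hcC : c ∈ compressionCone a := by
    intro ε hε
    obtain ⟨t, -, h⟩ := hc ε hε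
    refine ⟨v * t, fun i => ?_⟩
    have := h i
    simpa only [star_mul, mul_assoc] using this
  have hfc : 0 < f c := by
    set K := ∑ i, |α i| with hK
    have hK0 : 0 ≤ K := Finset.sum_nonneg fun i _ => abs_nonneg _
    obtain ⟨t, ht, h⟩ := hc (1 / (K + 1)) (by positivity)
    have e : (((1 - f c : ℝ)) : ℂ) • (1 : A)
        = ∑ i, (α i : ℂ) • (star t * (star v * a i * v) * t - (c i : ℂ) • (1 : A)) := by
      have e1 : ∑ i, (α i : ℂ) • (star t * (star v * a i * v) * t) = 1 := by
        have : ∑ i, (α i : ℂ) • (star t * (star v * a i * v) * t)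
            = - (star t * (star v * x * v) * t) := by
          rw [hx]
          simp only [mul_neg, neg_mul, neg_neg, Finset.mul_sum, Finset.sum_mul, mul_smul_comm,
            smul_mul_assoc]
        rw [this, hv]
        simp [ht]
      have e2 : ∑ i, (α i : ℂ) • ((c i : ℂ) • (1 : A)) = ((f c : ℝ) : ℂ) • (1 : A) := by
        rw [hf]
        push_cast
        rw [Finset.sum_smul]
        simp only [smul_smul]
      simp only [smul_sub, Finset.sum_sub_distrib]
      rw [e1, e2]
      push_cast
      rw [sub_smul, one_smul]
    have h1 : |1 - f c| ≤ K * (1 / (K + 1)) := by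
      calc |1 - f c| = ‖(((1 - f c : ℝ)) : ℂ) • (1 : A)‖ := by
            rw [norm_smul, CStarRing.norm_one, mul_one, Complex.norm_real, Real.norm_eq_abs]
        _ ≤ ∑ i, |α i| * (1 / (K + 1)) := by
            rw [e]
            refine norm_sum_le_of_le _ fun i _ => ?_
            rw [norm_smul, Complex.norm_real, Real.norm_eq_abs]
            gcongr
            exact (h i).le
        _ = K * (1 / (K + 1)) := by rw [hK, Finset.sum_mul]
    have h2 : K * (1 / (K + 1)) < 1 := by
      rw [mul_one_div, div_lt_one (by positivity)]; linarith
    linarith [le_abs_self (1 - f c)]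
  have := hfC _ (smul_mem_compressionCone hcC (show 0 ≤ u / f c by positivity))
  rw [map_smul, smul_eq_mul, div_mul_cancel₀ _ hfc.ne'] at this
  exact lt_irrefl _ this

open scoped ComplexOrder in
/-- Every positive functional on a purely infinite simple C⋆-algebra is, on finite sets, close to
a compression. -/
lemma exists_compress_near_positive_functional [PartialOrder A] [StarOrderedRing A] [Nontrivial A]
    (hnontriv : ∃ x : A, ∀ c : ℂ, x ≠ c • (1 : A))
    (hpi : ∀ x : A, x ≠ 0 → ∃ a b : A, a * x * b = 1) {ι : Type*} [Fintype ι] (a : ι → A)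
    {g : A →ₗ[ℂ] ℂ} (hg : ∀ y, 0 ≤ g (star y * y)) {ε : ℝ} (hε : 0 < ε) :
    ∃ w : A, ∀ i, ‖star w * a i * w - g (a i) • (1 : A)‖ < ε := by
  let b : ι ⊕ ι → A := Sum.elim (fun i => (realPart (a i) : A)) (fun i => (imaginaryPart (a i) : A))
  have hb : ∀ i, IsSelfAdjoint (b i) := by
    rintro (i | i)
    · exact (realPart (a i)).2
    · exact (imaginaryPart (a i)).2
  obtain ⟨w, hw⟩ := positive_functional_mem_compressionCone hnontriv hpi hb hg (ε / 2)
    (half_pos hε)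
  have hw' : ∀ i, ‖star w * b i * w - g (b i) • (1 : A)‖ < ε / 2 := by
    intro i
    have : g (b i) = ((g (b i)).re : ℂ) :=
      Complex.ext rfl (by simpa using (hb i).im_map_eq_zero_of_positive hg)
    rw [this]
    exact hw i
  refine ⟨w, fun i => ?_⟩
  have h1 := hw' (Sum.inl i)
  have h2 := hw' (Sum.inr i)
  simp only [b, Sum.elim_inl, Sum.elim_inr] at h1 h2
  have e : star w * a i * w - g (a i) • (1 : A)
      = (star w * (realPart (a i) : A) * w - g (realPart (a i) : A) • (1 : A))
        + Complex.I • (star w * (imaginaryPart (a i) : A) * w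
          - g (imaginaryPart (a i) : A) • (1 : A)) := by
    conv_lhs => rw [← realPart_add_I_smul_imaginaryPart (a i)]
    simp only [mul_add, add_mul, mul_smul_comm, smul_mul_assoc, map_add, map_smul, add_smul,
      smul_sub, smul_eq_mul, mul_smul]
    abel
  rw [e]
  refine (norm_add_le _ _).trans_lt ?_
  rw [norm_smul, Complex.norm_I, one_mul]
  linarith

open scoped ComplexOrder in
/-- A completely positive map into matrices is, on finite sets, close to a map
`a ↦ (vᵢ* a vⱼ)ᵢⱼ`. -/
lemma IsCP.exists_near_compression_matrix [PartialOrder A] [StarOrderedRing A] [Nontrivial A]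
    (hnontriv : ∃ x : A, ∀ c : ℂ, x ≠ c • (1 : A))
    (hpi : ∀ x : A, x ≠ 0 → ∃ a b : A, a * x * b = 1) {n : ℕ}
    {S : A →ₗ[ℂ] Matrix (Fin n) (Fin n) ℂ} (hS : IsCP S) (F : Finset A) {ε : ℝ} (hε : 0 < ε) :
    ∃ v : Fin n → A, ∀ a ∈ F, ∀ i j, ‖star (v i) * a * v j - S a i j • (1 : A)‖ < ε := by
  rcases Nat.eq_zero_or_pos n with rfl | hn
  · exact ⟨fun _ => 0, fun _ _ i => i.elim0⟩
  obtain ⟨r, hr⟩ := exists_cuntz_sequence hnontriv hpi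
  let s : Fin n → A := fun i => r i
  have hs : ∀ i j, star (s i) * s j = if i = j then 1 else 0 := by
    intro i j
    simp only [s, hr, Fin.ext_iff]
  let g : A →ₗ[ℂ] ℂ :=
    { toFun := fun x => ∑ i, ∑ j, S (star (s i) * x * s j) i j
      map_add' := fun x y => by
        simp only [mul_add, add_mul, map_add, Matrix.add_apply, Finset.sum_add_distrib]
      map_smul' := fun c x => by
        simp only [mul_smul_comm, smul_mul_assoc, map_smul, Matrix.smul_apply, Finset.smul_sum,
          RingHom.id_apply] }
  have hgdef : ∀ x, g x = ∑ i, ∑ j, S (star (s i) * x * s j) i j := fun _ => rfl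
  have hg : ∀ y, 0 ≤ g (star y * y) := by
    intro y
    let i₀ : Fin n := ⟨0, hn⟩
    obtain ⟨Z, hZ⟩ := hS n (Matrix.of fun i j => star (s i) * (star y * y) * s j)
      ⟨Matrix.of fun k j => if k = i₀ then y * s j else 0, by
        ext i j
        rw [Matrix.mul_apply, Finset.sum_eq_single i₀]
        · simp [Matrix.star_apply, mul_assoc]
        · intro k _ hk
          simp [hk]
        · simp⟩
    have hent : ∀ i j, S (star (s i) * (star y * y) * s j) i j
        = ∑ k, ∑ l, star (Z k i l i) * Z k j l j := by
      intro i j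
      have := congrArg (fun M => M i j) hZ
      simp only [Matrix.map_apply, Matrix.of_apply] at this
      rw [this, Matrix.mul_apply, Matrix.sum_apply]
      refine Finset.sum_congr rfl fun k _ => ?_
      rw [Matrix.mul_apply]
      rfl
    have htot : g (star y * y) = ∑ k, ∑ l, star (∑ j, Z k j l j) * ∑ j, Z k j l j := by
      rw [hgdef]
      simp only [hent, star_sum, Finset.sum_mul_sum]
      calc _ = ∑ i, ∑ k, ∑ j, ∑ l, star (Z k i l i) * Z k j l j :=
            Finset.sum_congr rfl fun i _ => Finset.sum_comm
        _ = ∑ k, ∑ i, ∑ j, ∑ l, star (Z k i l i) * Z k j l j := Finset.sum_comm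
        _ = ∑ k, ∑ i, ∑ l, ∑ j, star (Z k i l i) * Z k j l j :=
            Finset.sum_congr rfl fun k _ => Finset.sum_congr rfl fun i _ => Finset.sum_comm
        _ = _ := Finset.sum_congr rfl fun k _ => Finset.sum_comm
    rw [htot]
    exact Finset.sum_nonneg fun k _ => Finset.sum_nonneg fun l _ => star_mul_self_nonneg _
  obtain ⟨w, hw⟩ := exists_compress_near_positive_functional hnontriv hpi
    (fun p : F × Fin n × Fin n => s p.2.1 * (p.1 : A) * star (s p.2.2)) hg hε
  refine ⟨fun i => star (s i) * w, fun a ha i j => ?_⟩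
  have h := hw (⟨a, ha⟩, i, j)
  have hgs : g (s i * a * star (s j)) = S a i j := by
    rw [hgdef, Finset.sum_eq_single i, Finset.sum_eq_single j]
    · have : star (s i) * (s i * a * star (s j)) * s j = a := by
        calc star (s i) * (s i * a * star (s j)) * s j
            = (star (s i) * s i) * a * (star (s j) * s j) := by simp only [mul_assoc]
          _ = a := by simp [hs]
      rw [this]
    · intro l _ hl
      have : star (s i) * (s i * a * star (s j)) * s l
          = (star (s i) * s i) * a * (star (s j) * s l) := by simp only [mul_assoc]
      rw [this, hs j l, if_neg hl.symm]
      simp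
    · simp
    · intro l _ hl
      refine Finset.sum_eq_zero fun m _ => ?_
      have : star (s l) * (s i * a * star (s j)) * s m
          = (star (s l) * s i) * (a * star (s j) * s m) := by simp only [mul_assoc]
      rw [this, hs l i, if_neg hl]
      simp
    · simp
  simp only [hgs] at h
  have e : star (star (s i) * w) * a * (star (s j) * w)
      = star w * (s i * a * star (s j)) * w := by
    simp only [star_mul, star_star, mul_assoc]
  rw [e]
  exact h

/-- The Choi description of completely positive maps on matrix algebras. -/
lemma IsCP.exists_kraus {n : ℕ} {T : Matrix (Fin n) (Fin n) ℂ →ₗ[ℂ] A} (hT : IsCP T) :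
    ∃ Y : Fin n → Fin n → A, ∀ m, T m = ∑ k, ∑ i, ∑ j, m i j • (star (Y k i) * Y k j) := by
  rcases Nat.eq_zero_or_pos n with rfl | hn
  · refine ⟨fun i => i.elim0, fun m => ?_⟩
    rw [Subsingleton.elim m 0, map_zero]
    simp
  let i₀ : Fin n := ⟨0, hn⟩
  obtain ⟨Y, hY⟩ := hT n (Matrix.of fun i j => Matrix.single i j (1 : ℂ))
    ⟨Matrix.of fun k j => if k = i₀ then Matrix.single i₀ j (1 : ℂ) else 0, by
      ext1 i j
      rw [Matrix.mul_apply, Finset.sum_eq_single i₀]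
      · simp [Matrix.star_apply, Matrix.star_eq_conjTranspose]
      · intro k _ hk
        simp [hk]
      · simp⟩
  refine ⟨fun k i => Y k i, fun m => ?_⟩
  have hent : ∀ i j, T (Matrix.single i j 1) = ∑ k, star (Y k i) * Y k j := by
    intro i j
    have := congrArg (fun M => M i j) hY
    simp only [Matrix.map_apply, Matrix.of_apply] at this
    rw [this, Matrix.mul_apply]
    rfl
  conv_lhs => rw [Matrix.matrix_eq_sum_single m]
  have hsm : ∀ i j, Matrix.single i j (m i j) = m i j • Matrix.single i j (1 : ℂ) := by
    intro i j; simp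
  simp only [map_sum, hsm, map_smul, hent, Finset.smul_sum]
  calc _ = ∑ i, ∑ k, ∑ j, m i j • (star (Y k i) * Y k j) :=
        Finset.sum_congr rfl fun i _ => Finset.sum_comm
    _ = _ := Finset.sum_comm

/-- A composition of completely positive maps through a matrix algebra is close to a compression
by one element `s`, and there is an almost isometry `p` with range almost orthogonal to that
of `s`. -/
lemma exists_compress_near_comp [PartialOrder A] [StarOrderedRing A] [Nontrivial A]
    (hnontriv : ∃ x : A, ∀ c : ℂ, x ≠ c • (1 : A))
    (hpi : ∀ x : A, x ≠ 0 → ∃ a b : A, a * x * b = 1) {n : ℕ} (hn : 0 < n)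
    {S : A →ₗ[ℂ] Matrix (Fin n) (Fin n) ℂ} (hS : IsCP S) (hS1 : S 1 = 1)
    {T : Matrix (Fin n) (Fin n) ℂ →ₗ[ℂ] A} (hT : IsCP T) (F : Finset A) {ε : ℝ} (hε : 0 < ε) :
    ∃ s p : A, (∀ a ∈ F, ‖star s * a * s - T (S a)‖ < ε) ∧
      ‖star p * p - 1‖ < ε ∧ ‖star p * s‖ < ε := by
  classical
  obtain ⟨Y, hY⟩ := hT.exists_kraus
  obtain ⟨r, hr⟩ := exists_cuntz_sequence hnontriv hpi
  let u : Fin n × Fin n → A := fun x => r x.1 * Y x.1 x.2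
  set K := ∑ x, ‖u x‖ with hK
  have hK0 : 0 ≤ K := Finset.sum_nonneg fun _ _ => norm_nonneg _
  set η := ε / (K + 1) ^ 2 with hη
  have hη0 : 0 < η := by positivity
  have hηK : η * (K + 1) ^ 2 = ε := div_mul_cancel₀ _ (by positivity)
  obtain ⟨v, hv⟩ := hS.exists_near_compression_matrix hnontriv hpi (insert 1 F) hη0
  let i₀ : Fin n := ⟨0, hn⟩
  have hrn : star (r n) * r n = 1 := by rw [hr, if_pos rfl]
  have hrn1 : ‖r n‖ = 1 := by
    have : ‖r n‖ * ‖r n‖ = 1 := by rw [← CStarRing.norm_star_mul_self, hrn, CStarRing.norm_one]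
    nlinarith [norm_nonneg (r n)]
  refine ⟨∑ x, v x.2 * u x, v i₀ * r n, fun a ha => ?_, ?_, ?_⟩
  · have hTS : T (S a) = ∑ x, ∑ y, star (u x) * (S a x.2 y.2 • (1 : A)) * u y := by
      have huu : ∀ x y, star (u x) * (S a x.2 y.2 • (1 : A)) * u y
          = if x.1 = y.1 then S a x.2 y.2 • (star (Y x.1 x.2) * Y y.1 y.2) else 0 := by
        intro x y
        have : star (u x) * (S a x.2 y.2 • (1 : A)) * u y
            = S a x.2 y.2 • (star (Y x.1 x.2) * (star (r x.1) * r y.1) * Y y.1 y.2) := by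
          simp only [u, star_mul, mul_smul_comm, smul_mul_assoc, mul_one, mul_assoc]
        rw [this, hr]
        simp only [Fin.val_inj]
        split_ifs <;> simp
      simp only [huu, Fintype.sum_prod_type, hY]
      refine Finset.sum_congr rfl fun k _ => Finset.sum_congr rfl fun i _ => ?_
      rw [Finset.sum_comm]
      exact Finset.sum_congr rfl fun j _ => by simp
    have e : star (∑ x, v x.2 * u x) * a * (∑ x, v x.2 * u x) - T (S a)
        = ∑ x, ∑ y, star (u x) * (star (v x.2) * a * v y.2 - S a x.2 y.2 • (1 : A)) * u y := by
      rw [hTS]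
      simp only [mul_sub, sub_mul, Finset.sum_sub_distrib]
      congr 1
      rw [star_sum, Finset.sum_mul, Finset.sum_mul]
      refine Finset.sum_congr rfl fun x _ => ?_
      rw [Finset.mul_sum]
      refine Finset.sum_congr rfl fun y _ => ?_
      simp only [star_mul, mul_assoc]
    rw [e]
    calc _ ≤ ∑ x, ∑ y, ‖u x‖ * η * ‖u y‖ := by
          refine norm_sum_le_of_le _ fun x _ => norm_sum_le_of_le _ fun y _ => ?_
          refine norm_mul₃_le.trans ?_
          rw [norm_star]
          gcongr
          exact (hv a (Finset.mem_insert_of_mem ha) _ _).le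
      _ = K * η * K := by
          rw [hK, Finset.sum_mul, Finset.sum_mul]
          simp only [Finset.mul_sum]
      _ < ε := by nlinarith
  · have h := hv 1 (Finset.mem_insert_self _ _) i₀ i₀
    rw [hS1, Matrix.one_apply_eq, one_smul] at h
    have e : star (v i₀ * r n) * (v i₀ * r n) - 1
        = star (r n) * (star (v i₀) * 1 * v i₀ - 1) * r n := by
      rw [mul_sub, sub_mul, mul_one, mul_one, hrn]
      simp only [star_mul, mul_assoc]
    rw [e]
    refine (norm_star_mul_mul_le_of_isometry hrn hrn _).trans_lt (h.trans_le ?_)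
    rw [← hηK]
    exact le_mul_of_one_le_right hη0.le (one_le_pow₀ (by linarith))
  · have e : star (v i₀ * r n) * ∑ x, v x.2 * u x
        = ∑ x, star (r n) * (star (v i₀) * 1 * v x.2 - S 1 i₀ x.2 • (1 : A)) * u x := by
      rw [Finset.mul_sum]
      refine Finset.sum_congr rfl fun x _ => ?_
      have h0 : star (r n) * u x = 0 := by
        have hne : n ≠ (x.1 : ℕ) := x.1.2.ne'
        simp only [u]
        rw [← mul_assoc, hr, if_neg hne, zero_mul]
      rw [mul_sub, sub_mul, mul_smul_comm, smul_mul_assoc, mul_one (star (r n)), h0, smul_zero, sub_zero]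
      simp only [star_mul, mul_assoc, mul_one]
    rw [e]
    calc _ ≤ ∑ x, η * ‖u x‖ := by
          refine norm_sum_le_of_le _ fun x _ => norm_mul₃_le.trans ?_
          rw [norm_star, hrn1, one_mul]
          gcongr
          exact (hv 1 (Finset.mem_insert_self _ _) _ _).le
      _ = η * K := by rw [hK, Finset.mul_sum]
      _ < ε := by nlinarith

/-- An almost isometry whose range is almost orthogonal to that of another almost isometry can be
perturbed to a nonunitary isometry. -/
lemma exists_nonunitary_isometry_near [Nontrivial A] {s p : A} {δ : ℝ} (hδ : δ ≤ 1 / 4)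
    (hs : ‖star s * s - 1‖ < δ) (hp : ‖star p * p - 1‖ < δ) (hps : ‖star p * s‖ < δ) :
    ∃ t : A, star t * t = 1 ∧ t * star t ≠ 1 ∧
      ∀ a, ‖star t * a * t - star s * a * s‖ ≤ 6 * δ * ‖a‖ := by
  have hδ0 : 0 < δ := (norm_nonneg _).trans_lt hs
  obtain ⟨h, hsa, hh, hh1⟩ := exists_inv_sqrt_near_one (IsSelfAdjoint.star_mul_self s) hδ0.le
    (by linarith) hs.le
  have hsn : ‖s‖ ≤ 2 := by
    have h1 : ‖star s * s‖ ≤ ‖(1 : A)‖ + ‖star s * s - 1‖ := by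
      have := norm_add_le (1 : A) (star s * s - 1)
      rwa [add_sub_cancel] at this
    rw [CStarRing.norm_star_mul_self, CStarRing.norm_one] at h1
    nlinarith [norm_nonneg s]
  have hhn : ‖h‖ ≤ 2 := by
    have := norm_add_le (1 : A) (h - 1)
    rw [add_sub_cancel, CStarRing.norm_one] at this
    linarith
  have ht : star (s * h) * (s * h) = 1 := by
    rw [star_mul, hsa, ← hh]; simp only [mul_assoc]
  have htn : ‖s * h‖ = 1 := by
    have : ‖s * h‖ * ‖s * h‖ = 1 := by
      rw [← CStarRing.norm_star_mul_self, ht, CStarRing.norm_one]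
    nlinarith [norm_nonneg (s * h)]
  refine ⟨s * h, ht, fun hu => ?_, fun a => ?_⟩
  · have h1 : star p * p = (star p * s) * h * h * star (star p * s) := by
      calc star p * p = star p * (s * h * star (s * h)) * p := by rw [hu, mul_one]
        _ = _ := by simp only [star_mul, star_star, hsa, mul_assoc]
    have h2 : ‖star p * p‖ ≤ δ * 2 * 2 * δ := by
      rw [h1]
      refine (norm_mul_le _ _).trans ?_
      rw [norm_star]
      gcongr
      refine norm_mul₃_le.trans ?_
      gcongr
    have h3 : ‖(1 : A)‖ ≤ ‖star p * p‖ + ‖star p * p - 1‖ := norm_le_norm_add_norm_sub _ _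
    rw [CStarRing.norm_one] at h3
    nlinarith
  · have e : star (s * h) * a * (s * h) - star s * a * s
        = star (s * (h - 1)) * a * (s * h) + star s * a * (s * (h - 1)) := by
      simp only [mul_sub, sub_mul, star_sub, star_mul, mul_one]
      noncomm_ring
    have hd : ‖s * (h - 1)‖ ≤ 2 * δ := (norm_mul_le _ _).trans (by gcongr)
    rw [e]
    calc _ ≤ 2 * δ * ‖a‖ * 1 + 2 * ‖a‖ * (2 * δ) := by
          refine (norm_add_le _ _).trans (add_le_add (norm_mul₃_le.trans ?_)
            (norm_mul₃_le.trans ?_))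
          · rw [norm_star, htn]; gcongr
          · rw [norm_star]; gcongr
      _ = 6 * δ * ‖a‖ := by ring

end PurelyInfinite

/-- Let `A` be a unital purely infinite simple C*-algebra and
`V : A → A` a nuclear unital completely positive map (a pointwise norm limit of maps
factoring through matrix algebras by u.c.p. maps).  For every `ε > 0` and finite `F ⊆ A`
there is a nonunitary isometry `s ∈ A` with `‖s*·a·s − V(a)‖ < ε` for all `a ∈ F`. -/
theorem stmt_9 {A : Type*} [NormedRing A] [StarRing A] [CStarRing A] [CompleteSpace A]
    [NormedAlgebra ℂ A] [StarModule ℂ A]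
    (hnontriv : ∃ x : A, ∀ c : ℂ, x ≠ c • (1 : A))
    (hpi : ∀ x : A, x ≠ 0 → ∃ a b : A, a * x * b = 1)
    (V : A →ₗ[ℂ] A) (hV1 : V 1 = 1) (hVcp : IsCP V)
    (hVnuc : ∃ (d : ℕ → ℕ)
      (S : ∀ j : ℕ, A →ₗ[ℂ] Matrix (Fin (d j)) (Fin (d j)) ℂ)
      (T : ∀ j : ℕ, Matrix (Fin (d j)) (Fin (d j)) ℂ →ₗ[ℂ] A),
      (∀ j, S j 1 = 1 ∧ IsCP (S j) ∧ T j 1 = 1 ∧ IsCP (T j)) ∧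
      ∀ a : A, Filter.Tendsto (fun j => ‖T j (S j a) - V a‖) Filter.atTop (nhds 0))
    (ε : ℝ) (hε : 0 < ε) (F : Finset A) :
    ∃ s : A, star s * s = 1 ∧ s * star s ≠ 1 ∧
      ∀ a ∈ F, ‖star s * a * s - V a‖ < ε := by
  classical
  let : CStarAlgebra A := { }
  let : PartialOrder A := CStarAlgebra.spectralOrder A
  have : StarOrderedRing A := CStarAlgebra.spectralOrderedRing A
  have : Nontrivial A := by
    obtain ⟨x, hx⟩ := hnontriv
    exact ⟨x, (0 : ℂ) • 1, hx 0⟩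
  obtain ⟨d, S, T, hST, hlim⟩ := hVnuc
  set M := ∑ a ∈ F, ‖a‖ with hM
  have hM0 : 0 ≤ M := Finset.sum_nonneg fun _ _ => norm_nonneg _
  set δ := min (1 / 4) (ε / (6 * M + 3)) with hδ
  have hδ0 : 0 < δ := by positivity
  have hδ1 : δ ≤ 1 / 4 := min_le_left _ _
  have hδ2 : δ * (6 * M + 3) ≤ ε := by
    rw [← le_div_iff₀ (by positivity)]; exact min_le_right _ _
  have hev : ∀ᶠ j in Filter.atTop, ∀ a ∈ F, ‖T j (S j a) - V a‖ < δ :=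
    (Filter.eventually_all_finset F).2 fun a _ => (hlim a).eventually (gt_mem_nhds hδ0)
  obtain ⟨j, hj⟩ := hev.exists
  obtain ⟨hS1, hS, hT1, hT⟩ := hST j
  have hd : 0 < d j := by
    by_contra h
    have h0 : d j = 0 := by omega
    have : IsEmpty (Fin (d j)) := by rw [h0]; infer_instance
    have : (1 : Matrix (Fin (d j)) (Fin (d j)) ℂ) = 0 := Subsingleton.elim _ _
    rw [this, map_zero] at hT1
    exact zero_ne_one hT1
  obtain ⟨s, p, hs, hp, hps⟩ :=
    exists_compress_near_comp hnontriv hpi hd hS hS1 hT (insert 1 F) hδ0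
  have hs1 := hs 1 (Finset.mem_insert_self _ _)
  rw [hS1, hT1, mul_one] at hs1
  obtain ⟨t, ht, htu, hts⟩ := exists_nonunitary_isometry_near hδ1 hs1 hp hps
  refine ⟨t, ht, htu, fun a ha => ?_⟩
  have h1 : ‖a‖ ≤ M := Finset.single_le_sum (f := fun a => ‖a‖) (fun _ _ => norm_nonneg _) ha
  have h2 : 6 * δ * ‖a‖ ≤ 6 * δ * M := by gcongr
  calc ‖star t * a * t - V a‖
      = ‖(star t * a * t - star s * a * s) + (star s * a * s - T j (S j a))
          + (T j (S j a) - V a)‖ := by congr 1; abel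
    _ ≤ 6 * δ * ‖a‖ + ‖star s * a * s - T j (S j a)‖ + ‖T j (S j a) - V a‖ :=
        (norm_add₃_le).trans (by gcongr; exact hts a)
    _ < ε := by linarith [hs a (Finset.mem_insert_of_mem ha), hj a ha]
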